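/- If A ∈ ℝ^{n×n} is neutrally stable (all eigenvalues in the closed left half plane, and any purely imaginary eigenvalues are semisimple), then there exists a symmetric positive definite matrix P such that PA + AᵀP ≤ 0 (negative semidefinite). -/

import Mathlib

open Matrix

/-- A real square matrix is neutrally stable: every complex eigenvalue has
nonpositive real part, and eigenvalues on the imaginary axis are semisimple
(the kernel of `(A - λI)^2` equals the kernel of `A - λI`). -/
def NeutrallyStable {n : ℕ} (A : Matrix (Fin n) (Fin n) ℝ) : Prop :=
  ∀ lam ∈ spectrum ℂ (A.map (Complex.ofReal)),
    lam.re ≤ 0 ∧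
    (lam.re = 0 → ∀ v : Fin n → ℂ,
      ((A.map Complex.ofReal - lam • 1) ^ 2) *ᵥ v = 0 →
        (A.map Complex.ofReal - lam • 1) *ᵥ v = 0)

open scoped ComplexOrder

theorem ns_step {n : ℕ} (A X Y : Matrix (Fin n) (Fin n) ℂ) (lam : ℂ) (a : ℝ)
    (ha : lam.re = -a) (h : X * A = lam • X + (a : ℂ) • Y) :
    -(Xᴴ * X * A + Aᴴ * (Xᴴ * X)) =
      (a : ℂ) • ((X - Y)ᴴ * (X - Y)) + ((a : ℂ) • (Xᴴ * X) - (a : ℂ) • (Yᴴ * Y)) := by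
  have h2 : Aᴴ * Xᴴ = star lam • Xᴴ + (a : ℂ) • Yᴴ := by
    rw [← conjTranspose_mul, h]
    simp [conjTranspose_add, conjTranspose_smul]
  have h3 : star lam = -2 * (a : ℂ) - lam := by
    apply Complex.ext
    · simp [ha]; ring
    · simp
  rw [mul_assoc, h, ← mul_assoc, h2, h3]
  simp only [conjTranspose_sub, mul_add, add_mul, sub_mul, mul_sub, smul_mul_assoc,
    mul_smul_comm]
  module

theorem ns_block {n : ℕ} (A M : Matrix (Fin n) (Fin n) ℂ) (lam : ℂ) (m : ℕ)
    (hc : Commute A M) (hre : lam.re ≤ 0) (hm : (A - lam • 1) ^ m * M = 0)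
    (h0 : lam.re = 0 → (A - lam • 1) * M = 0) :
    ∃ R : Matrix (Fin n) (Fin n) ℂ, R.PosSemidef ∧
      (-((Mᴴ * M + R) * A + Aᴴ * (Mᴴ * M + R))).PosSemidef := by
  by_cases hz : lam.re = 0
  · refine ⟨0, PosSemidef.zero, ?_⟩
    have h1 : M * A = lam • M + ((0 : ℝ) : ℂ) • M := by
      have := h0 hz
      rw [sub_mul, hc.eq, sub_eq_zero] at this
      simpa using this
    rw [add_zero, ns_step A M M lam 0 (by simpa using hz) h1]
    simpa using PosSemidef.zero
  · set a : ℝ := -lam.re with ha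
    have hapos : 0 < a := by
      have : lam.re < 0 := lt_of_le_of_ne hre hz
      linarith
    have hane : (a : ℂ) ≠ 0 := by exact_mod_cast hapos.ne'
    have hanon : (0 : ℂ) ≤ (a : ℂ) := by exact_mod_cast hapos.le
    set N := A - lam • (1 : Matrix (Fin n) (Fin n) ℂ) with hN
    let B : ℕ → Matrix (Fin n) (Fin n) ℂ := fun k => ((a : ℂ)⁻¹) ^ k • (N ^ k * M)
    have hAN : A = lam • 1 + N := by rw [hN]; abel
    have hNM : M * A = lam • M + N * M := by
      rw [← hc.eq]
      conv_lhs => rw [hAN]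
      simp [add_mul]
    have hB : ∀ k, B k * A = lam • B k + (a : ℂ) • B (k + 1) := by
      intro k
      simp only [B, smul_mul_assoc, mul_assoc, hNM, mul_add, smul_add, mul_smul_comm]
      rw [smul_comm lam, ← mul_assoc, ← pow_succ, smul_smul (a : ℂ), pow_succ (a : ℂ)⁻¹]
      congr 2
      field_simp
    have hB0 : B 0 = M := by simp [B]
    have hBm : B m = 0 := by simp [B, hm]
    refine ⟨∑ k ∈ Finset.range m, (B (k + 1))ᴴ * B (k + 1),
      posSemidef_sum _ fun k _ => posSemidef_conjTranspose_mul_self _, ?_⟩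
    have hS : Mᴴ * M + ∑ k ∈ Finset.range m, (B (k + 1))ᴴ * B (k + 1)
        = ∑ k ∈ Finset.range m, (B k)ᴴ * B k := by
      have h1 := Finset.sum_range_succ' (fun k => (B k)ᴴ * B k) m
      have h2 := Finset.sum_range_succ (fun k => (B k)ᴴ * B k) m
      rw [h1] at h2
      simp only [hB0, hBm, mul_zero, add_zero] at h2
      rw [← h2, add_comm]
    have hT : -((∑ k ∈ Finset.range m, (B k)ᴴ * B k) * A
          + Aᴴ * (∑ k ∈ Finset.range m, (B k)ᴴ * B k))
        = (∑ k ∈ Finset.range m, (a : ℂ) • ((B k - B (k + 1))ᴴ * (B k - B (k + 1))))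
          + (a : ℂ) • (Mᴴ * M) := by
      rw [Finset.sum_mul, Finset.mul_sum, ← Finset.sum_add_distrib, ← Finset.sum_neg_distrib]
      rw [Finset.sum_congr rfl fun k _ => ns_step A (B k) (B (k + 1)) lam a (by simp [ha]) (hB k)]
      rw [Finset.sum_add_distrib, Finset.sum_range_sub' (fun k => (a : ℂ) • ((B k)ᴴ * B k))]
      simp [hB0, hBm]
    rw [hS, hT]
    exact (posSemidef_sum _ fun k _ => (posSemidef_conjTranspose_mul_self _).smul hanon).add
      ((posSemidef_conjTranspose_mul_self _).smul hanon)

theorem ns_ker {n : ℕ} (N : Matrix (Fin n) (Fin n) ℂ)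
    (h : ∀ v : Fin n → ℂ, (N ^ 2) *ᵥ v = 0 → N *ᵥ v = 0) (m : ℕ) :
    ∀ v : Fin n → ℂ, (N ^ (m + 1)) *ᵥ v = 0 → N *ᵥ v = 0 := by
  induction m with
  | zero => intro v hv; simpa using hv
  | succ k ih =>
    intro v hv
    apply h
    rw [pow_two, ← mulVec_mulVec]
    apply ih
    rw [mulVec_mulVec, ← pow_succ]
    exact hv

theorem ns_quad {n : ℕ} (Q : Matrix (Fin n) (Fin n) ℂ) (x : Fin n → ℝ) :
    star x ⬝ᵥ (Q.map Complex.re *ᵥ x) =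
      (star (fun i => (x i : ℂ)) ⬝ᵥ (Q *ᵥ (fun i => (x i : ℂ)))).re := by
  simp [dotProduct, mulVec]

theorem ns_herm {n : ℕ} (Q : Matrix (Fin n) (Fin n) ℂ) (h : Q.IsHermitian) :
    (Q.map Complex.re).IsHermitian := by
  ext i j
  have := congrArg Complex.re (h.apply i j)
  simpa using this

theorem ns_psd {n : ℕ} (Q : Matrix (Fin n) (Fin n) ℂ) (h : Q.PosSemidef) :
    (Q.map Complex.re).PosSemidef := by
  refine PosSemidef.of_dotProduct_mulVec_nonneg (ns_herm Q h.1) fun x => ?_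
  rw [ns_quad]
  exact (Complex.le_def.1 (h.dotProduct_mulVec_nonneg _)).1

theorem ns_pd {n : ℕ} (Q : Matrix (Fin n) (Fin n) ℂ) (h : Q.PosDef) :
    (Q.map Complex.re).PosDef := by
  refine PosDef.of_dotProduct_mulVec_pos (ns_herm Q h.1) fun x hx => ?_
  rw [ns_quad]
  refine (Complex.lt_def.1 (h.dotProduct_mulVec_pos ?_)).1
  intro h0
  apply hx
  funext i
  simpa using congrFun h0 i

/-- Matrices cutting out the generalized eigenspaces. -/
theorem ns_decomp {n : ℕ} [Nonempty (Fin n)] (A : Matrix (Fin n) (Fin n) ℂ) :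
    ∃ (t : Finset ℂ) (m : ℂ → ℕ) (M : ℂ → Matrix (Fin n) (Fin n) ℂ),
      (∀ l ∈ t, l ∈ spectrum ℂ A) ∧ (∀ l, Commute A (M l)) ∧
      (∀ l ∈ t, (A - l • 1) ^ (m l) * M l = 0) ∧
      (∀ v : Fin n → ℂ, (∀ l ∈ t, M l *ᵥ v = 0) → v = 0) := by
  classical
  let p := A.charpoly
  let s : ℂ → Polynomial ℂ := fun l => (Polynomial.X - Polynomial.C l) ^ p.rootMultiplicity l
  let t := p.roots.toFinset
  have hp : p = ∏ l ∈ t, s l := by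
    rw [← Polynomial.prod_multiset_root_eq_finset_root]
    exact (IsAlgClosed.splits p).eq_prod_roots_of_monic A.charpoly_monic
  have hCH : Polynomial.aeval A p = 0 := A.aeval_self_charpoly
  have hne : t.Nonempty := by
    rw [Finset.nonempty_iff_ne_empty]
    intro h
    rw [hp, h] at hCH
    simp at hCH
  refine ⟨t, fun l => p.rootMultiplicity l,
    fun l => Polynomial.aeval A (∏ j ∈ t \ {l}, s j), ?_, ?_, ?_, ?_⟩
  · intro l hl
    rw [mem_spectrum_iff_isRoot_charpoly]
    exact Polynomial.isRoot_of_mem_roots (Multiset.mem_toFinset.1 hl)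
  · intro l
    have := Polynomial.aeval_X (R := ℂ) A
    conv => arg 1; rw [← this]
    rw [Commute, SemiconjBy, ← map_mul, ← map_mul, mul_comm]
  · intro l hl
    have h1 : (A - l • 1) ^ (p.rootMultiplicity l) = Polynomial.aeval A (s l) := by
      simp [s, Algebra.algebraMap_eq_smul_one]
    rw [h1, ← map_mul, ← hCH, hp, Finset.sdiff_singleton_eq_erase, Finset.mul_prod_erase _ _ hl]
  · intro v hv
    have hco : Pairwise (Function.onFun IsCoprime fun i : t => s i) := by
      intro i j hij
      exact (Polynomial.pairwise_coprime_X_sub_C Subtype.val_injective hij).pow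
    obtain ⟨μ, hμ⟩ := (exists_sum_eq_one_iff_pairwise_coprime hne).2 hco
    have h1 := congrArg (fun q => Polynomial.aeval A q *ᵥ v) hμ
    simp only [map_sum, map_one, one_mulVec, sum_mulVec] at h1
    rw [← h1]
    refine Finset.sum_eq_zero fun l hl => ?_
    rw [map_mul, ← mulVec_mulVec, hv l hl, mulVec_zero]

theorem neutrally_stable_lyapunov {n : ℕ} (A : Matrix (Fin n) (Fin n) ℝ)
    (hA : NeutrallyStable A) :
    ∃ P : Matrix (Fin n) (Fin n) ℝ, P.PosDef ∧ (-(P * A + Aᵀ * P)).PosSemidef := by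
  rcases isEmpty_or_nonempty (Fin n) with he | hne
  · refine ⟨1, PosDef.one, ?_⟩
    rw [Subsingleton.elim (-(1 * A + Aᵀ * 1)) 0]
    exact PosSemidef.zero
  obtain ⟨t, m, M, hsp, hcomm, hM, hker⟩ := ns_decomp (A.map Complex.ofReal)
  set Ac := A.map Complex.ofReal with hAc
  have hblk : ∀ l ∈ t, ∃ R : Matrix (Fin n) (Fin n) ℂ, R.PosSemidef ∧
      (-(((M l)ᴴ * M l + R) * Ac + Acᴴ * ((M l)ᴴ * M l + R))).PosSemidef := by
    intro l hl
    obtain ⟨h1, h2⟩ := hA l (hsp l hl)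
    refine ns_block Ac (M l) l (m l) (hcomm l) h1 (hM l hl) fun h0 => ?_
    apply Matrix.ext_of_mulVec_single
    intro i
    rw [zero_mulVec, ← mulVec_mulVec]
    apply ns_ker _ (h2 h0) (m l)
    rw [mulVec_mulVec, pow_succ', mul_assoc, hM l hl, mul_zero, zero_mulVec]
  choose! R hR1 hR2 using hblk
  let P : Matrix (Fin n) (Fin n) ℂ := ∑ l ∈ t, ((M l)ᴴ * M l + R l)
  have hP : P.PosDef := by
    simp only [P]
    rw [Finset.sum_add_distrib]
    refine PosDef.add_posSemidef ?_ (posSemidef_sum _ hR1)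
    refine PosDef.of_dotProduct_mulVec_pos
      (posSemidef_sum _ fun l _ => posSemidef_conjTranspose_mul_self (M l)).1 fun v hv => ?_
    have hq : ∀ l, star v ⬝ᵥ (((M l)ᴴ * M l) *ᵥ v) = star (M l *ᵥ v) ⬝ᵥ (M l *ᵥ v) := by
      intro l
      rw [← mulVec_mulVec, dotProduct_mulVec, star_mulVec]
    rw [sum_mulVec, dotProduct_sum]
    simp only [hq]
    have hex : ∃ l ∈ t, M l *ᵥ v ≠ 0 := by
      by_contra! h
      exact hv (hker v h)
    obtain ⟨l, hl, hlv⟩ := hex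
    exact Finset.sum_pos' (fun l _ => dotProduct_star_self_nonneg _)
      ⟨l, hl, dotProduct_star_self_pos_iff.2 hlv⟩
  have hQ : (-(P * Ac + Acᴴ * P)).PosSemidef := by
    simp only [P]
    rw [Finset.sum_mul, Finset.mul_sum, ← Finset.sum_add_distrib, ← Finset.sum_neg_distrib]
    exact posSemidef_sum _ hR2
  refine ⟨P.map Complex.re, ns_pd P hP, ?_⟩
  convert ns_psd _ hQ using 1
  ext i j
  simp [Matrix.mul_apply, hAc]
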